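/- Let g be a continuous real function on S_U. Then Σ_{j=1}^k w_j Φ(f(A_j)) − g(B_U) ≤ ( max_{x ∈ S_U} (x − g(x)) )·1_K in the Loewner order, where g(B_U) is defined by continuous functional calculus and 1_K is the identity operator on K. -/

import Mathlib

open ContinuousLinearMap in
/-- The Kantorovich constant `K(m', M', r)`, with the convention that it equals `1`
for `r = 0` and `r = 1`. -/
noncomputable def kantorovich (m M r : ℝ) : ℝ :=
  if r = 0 ∨ r = 1 then 1 else
    ((m * M ^ r - M * m ^ r) / ((r - 1) * (M - m))) *
      (((r - 1) * (M ^ r - m ^ r)) / (r * (m * M ^ r - M * m ^ r))) ^ r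

open ContinuousLinearMap Polynomial

theorem one_le_kantorovich {m M : ℝ} (hm : 0 < m) (hmM : m < M) (n : ℕ) :
    1 ≤ kantorovich m M n := by
  unfold kantorovich
  split_ifs with h
  · exact le_rfl
  push Not at h
  obtain ⟨h0, h1⟩ := h
  have hn : 2 ≤ n := by
    have h0' : n ≠ 0 := by exact_mod_cast h0
    have h1' : n ≠ 1 := by exact_mod_cast h1
    omega
  have hn1 : (0 : ℝ) < (n : ℝ) - 1 := by
    have : (2 : ℝ) ≤ n := by exact_mod_cast hn
    linarith
  have hn0 : (0 : ℝ) < n := by linarith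
  have hM : 0 < M := hm.trans hmM
  simp only [Real.rpow_natCast]
  have hD : 0 < m * M ^ n - M * m ^ n := by
    obtain ⟨p, rfl⟩ : ∃ p, n = p + 2 := ⟨n - 2, by omega⟩
    have hp : m ^ (p + 1) < M ^ (p + 1) := pow_lt_pow_left₀ hmM hm.le (by omega)
    have := mul_lt_mul_of_pos_left hp (mul_pos hm hM)
    have e : m * M ^ (p + 2) - M * m ^ (p + 2) = m * M * M ^ (p + 1) - m * M * m ^ (p + 1) := by
      ring
    linarith
  set D := m * M ^ n - M * m ^ n with hDdef
  set u := (((n : ℝ) - 1) * (M ^ n - m ^ n)) / (n * D) with hu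
  have hMm : 0 < M - m := sub_pos.2 hmM
  have hmn : 0 < m ^ n := pow_pos hm n
  have hu0 : 0 ≤ u := by
    have : m ^ n ≤ M ^ n := pow_le_pow_left₀ hm.le hmM.le n
    have : 0 ≤ M ^ n - m ^ n := sub_nonneg.2 this
    positivity
  have hB := one_add_mul_le_pow (a := m * u - 1) (by nlinarith [mul_nonneg hm.le hu0]) n
  have e : 1 + (n : ℝ) * (m * u - 1) = ((n : ℝ) - 1) * (M - m) * m ^ n / D := by
    rw [hu]
    field_simp
    rw [hDdef]
    ring
  rw [e, add_sub_cancel, mul_pow, div_le_iff₀ hD] at hB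
  rw [div_mul_eq_mul_div, le_div_iff₀ (by positivity), one_mul]
  refine le_of_mul_le_mul_right ?_ hmn
  linarith

/-- A self-adjoint element whose spectrum lies in a compact set `S` satisfies
`b - g(b) ≤ max_S (x - g x)`. -/
theorem sub_cfc_le_sSup {B : Type*} [CStarAlgebra B] [PartialOrder B] [StarOrderedRing B]
    {b : B} (hb : IsSelfAdjoint b) {S : Set ℝ} (hS : IsCompact S) (hbS : spectrum ℝ b ⊆ S)
    {g : ℝ → ℝ} (hg : ContinuousOn g S) :
    b - cfc g b ≤ sSup ((fun x => x - g x) '' S) • (1 : B) := by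
  have hg' := hg.mono hbS
  have hc : ContinuousOn (fun x => x - g x) S := continuousOn_id.sub hg
  have e : b - cfc g b = cfc (fun x => x - g x) b := by
    rw [cfc_sub (fun x => x) g b continuousOn_id hg', cfc_id' ℝ b]
  rw [e, ← Algebra.algebraMap_eq_smul_one]
  exact cfc_le_algebraMap _ _ _ (fun x hx =>
    le_csSup (hS.image_of_continuousOn hc).bddAbove ⟨x, hbS hx, rfl⟩) (hc.mono hbS)

theorem sum_smul_cfc_pow {B : Type*} [CStarAlgebra B] {b : B} (hb : IsSelfAdjoint b)
    (s : Finset ℕ) (a : ℕ → ℝ) {f : ℝ → ℝ} (hf : ContinuousOn f (spectrum ℝ b)) :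
    ∑ i ∈ s, a i • (cfc f b) ^ i = cfc (fun x => ∑ i ∈ s, a i * f x ^ i) b := by
  have e : (fun x => ∑ i ∈ s, a i * f x ^ i) = ∑ i ∈ s, fun x => a i * f x ^ i := by
    ext x
    simp
  rw [e, cfc_sum (fun i x => a i * f x ^ i) b s fun i _ => continuousOn_const.mul (hf.pow i)]
  refine Finset.sum_congr rfl fun i _ => ?_
  rw [cfc_const_mul (a i) (fun x => f x ^ i) b (hf.pow i), cfc_pow f i b hf hb]

theorem sum_smul_cfc_pow_le_cfc {B : Type*} [CStarAlgebra B] [PartialOrder B] [StarOrderedRing B]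
    {b : B} (hb : IsSelfAdjoint b) (s : Finset ℕ) (a : ℕ → ℝ) {f q : ℝ → ℝ}
    (hf : ContinuousOn f (spectrum ℝ b)) (hq : ContinuousOn q (spectrum ℝ b))
    (h : ∀ x ∈ spectrum ℝ b, ∑ i ∈ s, a i * f x ^ i ≤ q x) :
    ∑ i ∈ s, a i • (cfc f b) ^ i ≤ cfc q b := by
  rw [sum_smul_cfc_pow hb s a hf]
  exact cfc_mono h (continuousOn_finsetSum _ fun i _ => continuousOn_const.mul (hf.pow i)) hq

theorem spectrum_subset_of_sInf_le_of_le_sSup {B : Type*} [CStarAlgebra B] [PartialOrder B]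
    [StarOrderedRing B] {b : B} (hb : IsSelfAdjoint b) {S : Set ℝ} (hS : IsCompact S)
    (hne : S.Nonempty) (hconv : Convex ℝ S) (hlo : algebraMap ℝ B (sInf S) ≤ b)
    (hhi : b ≤ algebraMap ℝ B (sSup S)) : spectrum ℝ b ⊆ S := by
  intro x hx
  exact hconv.ordConnected.out (hS.sInf_mem hne) (hS.sSup_mem hne)
    ⟨(algebraMap_le_iff_le_spectrum hb).1 hlo x hx, (le_algebraMap_iff_spectrum_le hb).1 hhi x hx⟩

section Compression

variable {H K : Type*} [NormedAddCommGroup H] [InnerProductSpace ℂ H] [CompleteSpace H]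
  [NormedAddCommGroup K] [InnerProductSpace ℂ K] [CompleteSpace K]

theorem adjoint_conj_mono (V : K →L[ℂ] H) {X Y : H →L[ℂ] H} (h : X ≤ Y) :
    (adjoint V) ∘L X ∘L V ≤ (adjoint V) ∘L Y ∘L V := by
  rw [ContinuousLinearMap.le_def] at h ⊢
  simpa [ContinuousLinearMap.sub_comp, ContinuousLinearMap.comp_sub] using h.adjoint_conj V

theorem adjoint_conj_algebraMap {V : K →L[ℂ] H} (hV : (adjoint V) ∘L V = 1) (c : ℝ) :
    (adjoint V) ∘L (algebraMap ℝ (H →L[ℂ] H) c) ∘L V = algebraMap ℝ (K →L[ℂ] K) c := by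
  rw [Algebra.algebraMap_eq_smul_one, Algebra.algebraMap_eq_smul_one, ← hV]
  ext x
  simp

theorem algebraMap_le_sum_adjoint_conj {V : K →L[ℂ] H} (hV : (adjoint V) ∘L V = 1)
    {ι : Type*} [Fintype ι] {w : ι → ℝ} (hw : ∀ j, 0 ≤ w j) (hw1 : ∑ j, w j = 1)
    {X : ι → H →L[ℂ] H} {c : ℝ} (h : ∀ j, algebraMap ℝ (H →L[ℂ] H) c ≤ X j) :
    algebraMap ℝ (K →L[ℂ] K) c ≤ ∑ j, w j • ((adjoint V) ∘L X j ∘L V) := by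
  calc algebraMap ℝ (K →L[ℂ] K) c = ∑ j, w j • algebraMap ℝ (K →L[ℂ] K) c := by
        rw [← Finset.sum_smul, hw1, one_smul]
    _ ≤ _ := Finset.sum_le_sum fun j _ => smul_le_smul_of_nonneg_left
        (by rw [← adjoint_conj_algebraMap hV c]; exact adjoint_conj_mono V (h j)) (hw j)

theorem sum_adjoint_conj_le_algebraMap {V : K →L[ℂ] H} (hV : (adjoint V) ∘L V = 1)
    {ι : Type*} [Fintype ι] {w : ι → ℝ} (hw : ∀ j, 0 ≤ w j) (hw1 : ∑ j, w j = 1)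
    {X : ι → H →L[ℂ] H} {c : ℝ} (h : ∀ j, X j ≤ algebraMap ℝ (H →L[ℂ] H) c) :
    ∑ j, w j • ((adjoint V) ∘L X j ∘L V) ≤ algebraMap ℝ (K →L[ℂ] K) c := by
  calc _ ≤ ∑ j, w j • algebraMap ℝ (K →L[ℂ] K) c :=
        Finset.sum_le_sum fun j _ => smul_le_smul_of_nonneg_left
          (by rw [← adjoint_conj_algebraMap hV c]; exact adjoint_conj_mono V (h j)) (hw j)
    _ = _ := by rw [← Finset.sum_smul, hw1, one_smul]

end Compression

theorem sInf_image_Icc_pos {φ : ℝ → ℝ} {a b : ℝ} (hab : a ≤ b)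
    (hφ : ContinuousOn φ (Set.Icc a b)) (hpos : ∀ x ∈ Set.Icc a b, 0 < φ x) :
    0 < sInf (φ '' Set.Icc a b) := by
  obtain ⟨x, hx, hx'⟩ := (isCompact_Icc.image_of_continuousOn hφ).sInf_mem
    ((Set.nonempty_Icc.2 hab).image φ)
  exact hx' ▸ hpos x hx

theorem sum_mul_pow_le_of_sign_split (I : ℕ) (a κ l : ℕ → ℝ) {x y z : ℝ} (hx : 0 ≤ x)
    (hxy : x ≤ y) (hyz : y ≤ z) (hκ : ∀ i, 1 ≤ κ i) (hl : ∀ i, l i ≤ 1) :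
    ∑ i ∈ Finset.range (I + 1), a i * y ^ i ≤
      (∑ i ∈ (Finset.range (I + 1)).filter (fun i => 0 ≤ a i), a i * κ i * z ^ i) +
      ∑ i ∈ (Finset.range (I + 1)).filter (fun i => a i < 0), a i * l i * x ^ i := by
  rw [← Finset.sum_filter_add_sum_filter_not (Finset.range (I + 1)) (fun i => 0 ≤ a i)]
  simp only [not_le]
  refine add_le_add (Finset.sum_le_sum fun i hi => ?_) (Finset.sum_le_sum fun i hi => ?_)
  · have hai := (Finset.mem_filter.1 hi).2
    rw [mul_assoc]
    refine mul_le_mul_of_nonneg_left ?_ hai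
    have hyz' : y ^ i ≤ z ^ i := pow_le_pow_left₀ (hx.trans hxy) hyz i
    have hz : 0 ≤ z ^ i := pow_nonneg ((hx.trans hxy).trans hyz) i
    exact hyz'.trans (le_mul_of_one_le_left hz (hκ i))
  · have hai := (Finset.mem_filter.1 hi).2
    rw [mul_assoc]
    refine mul_le_mul_of_nonpos_left ?_ hai.le
    exact (mul_le_of_le_one_left (pow_nonneg hx i) (hl i)).trans (pow_le_pow_left₀ hx hxy i)

theorem stmt14
    {H K : Type*} [NormedAddCommGroup H] [InnerProductSpace ℂ H] [CompleteSpace H]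
    [NormedAddCommGroup K] [InnerProductSpace ℂ K] [CompleteSpace K]
    (V : K →L[ℂ] H) (hV : (adjoint V) ∘L V = 1)
    (I : ℕ) (a : ℕ → ℝ)
    (k : ℕ) (hk : 1 ≤ k)
    (w : Fin k → ℝ) (hw : ∀ j, 0 ≤ w j) (hw1 : ∑ j, w j = 1)
    (m M : Fin k → ℝ) (hmM : ∀ j, m j < M j)
    (A : Fin k → H →L[ℂ] H) (hA : ∀ j, IsSelfAdjoint (A j))
    (hspec : ∀ j, spectrum ℝ (A j) ⊆ Set.Icc (m j) (M j))
    (f : ℝ → ℝ) (hf : ContinuousOn f (⋃ j, Set.Icc (m j) (M j)))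
    (pL pU : Polynomial ℝ)
    (hp : ∀ x ∈ ⋃ j, Set.Icc (m j) (M j),
      0 < pL.eval x ∧ pL.eval x ≤ f x ∧ f x ≤ pU.eval x)
    (mU MU mL ML : Fin k → ℝ)
    (hmU : ∀ j, mU j = sInf ((fun x => pU.eval x) '' Set.Icc (m j) (M j)))
    (hMU : ∀ j, MU j = sSup ((fun x => pU.eval x) '' Set.Icc (m j) (M j)))
    (hmL : ∀ j, mL j = sInf ((fun x => pL.eval x) '' Set.Icc (m j) (M j)))
    (hML : ∀ j, ML j = sSup ((fun x => pL.eval x) '' Set.Icc (m j) (M j)))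
    (hUlt : ∀ j, mU j < MU j) (hLlt : ∀ j, mL j < ML j)
    (qU qL : Fin k → ℝ → ℝ)
    (hqU : ∀ j x, qU j x =
      (∑ i ∈ (Finset.range (I + 1)).filter (fun i => 0 ≤ a i),
        a i * kantorovich (mU j) (MU j) (i : ℝ) * (pU.eval x) ^ i) +
      ∑ i ∈ (Finset.range (I + 1)).filter (fun i => a i < 0),
        a i * (kantorovich (mL j) (ML j) (i : ℝ))⁻¹ * (pL.eval x) ^ i)
    (hqL : ∀ j x, qL j x =
      (∑ i ∈ (Finset.range (I + 1)).filter (fun i => 0 ≤ a i),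
        a i * (kantorovich (mL j) (ML j) (i : ℝ))⁻¹ * (pL.eval x) ^ i) +
      ∑ i ∈ (Finset.range (I + 1)).filter (fun i => a i < 0),
        a i * kantorovich (mU j) (MU j) (i : ℝ) * (pU.eval x) ^ i)
    (BU BL : K →L[ℂ] K)
    (hBU : BU = ∑ j, w j • ((adjoint V) ∘L (cfc (qU j) (A j)) ∘L V))
    (hBL : BL = ∑ j, w j • ((adjoint V) ∘L (cfc (qL j) (A j)) ∘L V))
    (SU SL : Set ℝ)
    (hSU : SU = closure (convexHull ℝ (⋃ j, qU j '' Set.Icc (m j) (M j))))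
    (hSL : SL = closure (convexHull ℝ (⋃ j, qL j '' Set.Icc (m j) (M j))))
    (g : ℝ → ℝ) (hg : ContinuousOn g SU) :
    (∑ j, w j • ((adjoint V) ∘L (∑ i ∈ Finset.range (I + 1), a i • (cfc f (A j)) ^ i) ∘L V)) - cfc g BU ≤
      (sSup ((fun x => x - g x) '' SU)) • (1 : K →L[ℂ] K) := by
  have hsub : ∀ j, Set.Icc (m j) (M j) ⊆ ⋃ j, Set.Icc (m j) (M j) :=
    fun j => Set.subset_iUnion (fun j => Set.Icc (m j) (M j)) j
  have hqc : ∀ j, Continuous (qU j) := fun j => by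
    rw [funext (hqU j)]
    fun_prop
  have hfA : ∀ j, ContinuousOn f (spectrum ℝ (A j)) := fun j => hf.mono ((hspec j).trans (hsub j))
  have hcompact : IsCompact SU := by
    rw [hSU]
    refine Bornology.IsBounded.isCompact_closure ?_
    rw [isBounded_convexHull]
    exact (isCompact_iUnion fun j => isCompact_Icc.image (hqc j)).isBounded
  have hqS : ∀ j, ∀ x ∈ Set.Icc (m j) (M j), qU j x ∈ SU := fun j x hx => by
    rw [hSU]
    exact subset_closure (subset_convexHull ℝ _ (Set.mem_iUnion.2 ⟨j, x, hx, rfl⟩))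
  have hne : SU.Nonempty :=
    ⟨_, hqS ⟨0, hk⟩ _ (Set.left_mem_Icc.2 (hmM _).le)⟩
  have hconv : Convex ℝ SU := hSU ▸ (convex_convexHull ℝ _).closure
  have hlo : algebraMap ℝ (K →L[ℂ] K) (sInf SU) ≤ BU := by
    rw [hBU]
    exact algebraMap_le_sum_adjoint_conj hV hw hw1 fun j => algebraMap_le_cfc _ _ _
      (fun x hx => csInf_le hcompact.bddBelow (hqS j x (hspec j hx))) (hqc j).continuousOn (hA j)
  have hhi : BU ≤ algebraMap ℝ (K →L[ℂ] K) (sSup SU) := by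
    rw [hBU]
    exact sum_adjoint_conj_le_algebraMap hV hw hw1 fun j => cfc_le_algebraMap _ _ _
      (fun x hx => le_csSup hcompact.bddAbove (hqS j x (hspec j hx))) (hqc j).continuousOn (hA j)
  have hsa : IsSelfAdjoint BU :=
    (IsSelfAdjoint.algebraMap _ (IsSelfAdjoint.all (sInf SU))).of_ge hlo
  have hmain : ∑ j, w j • ((adjoint V) ∘L
      (∑ i ∈ Finset.range (I + 1), a i • (cfc f (A j)) ^ i) ∘L V) ≤ BU := by
    rw [hBU]
    refine Finset.sum_le_sum fun j _ =>
      smul_le_smul_of_nonneg_left (adjoint_conj_mono V ?_) (hw j)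
    have hmUpos : 0 < mU j := hmU j ▸ sInf_image_Icc_pos (hmM j).le pU.continuousOn
      fun x hx => by have := hp x (hsub j hx); linarith
    have hmLpos : 0 < mL j := hmL j ▸ sInf_image_Icc_pos (hmM j).le pL.continuousOn
      fun x hx => (hp x (hsub j hx)).1
    refine sum_smul_cfc_pow_le_cfc (hA j) _ a (hfA j) (hqc j).continuousOn fun x hx => ?_
    obtain ⟨h0, h1, h2⟩ := hp x (hsub j (hspec j hx))
    rw [hqU]
    exact sum_mul_pow_le_of_sign_split I a (fun i => kantorovich (mU j) (MU j) i)
      (fun i => (kantorovich (mL j) (ML j) i)⁻¹) h0.le h1 h2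
      (fun i => one_le_kantorovich hmUpos (hUlt j) i)
      (fun i => inv_le_one_of_one_le₀ (one_le_kantorovich hmLpos (hLlt j) i))
  exact (sub_le_sub_right hmain _).trans (sub_cfc_le_sSup hsa hcompact
    (spectrum_subset_of_sInf_le_of_le_sSup hsa hcompact hne hconv hlo hhi) hg)
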